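/- Let N ≥ 1, let ℋ_0, …, ℋ_{2N−1} be finite-dimensional complex Hilbert spaces with Hermitian Hamiltonians H_0, …, H_{2N−1}, and let C be a positive semidefinite matrix on ⊗_{n=0}^{2N−1} ℋ_n satisfying the comb causality conditions. For a density matrix ρ on the joint input ⊗_{m=1}^{N} ℋ_{2m−2}, write C*ρ := Tr_{inputs}[C (ρ^T ⊗ I_{outputs})]. Then the following are equivalent: (i) there exist real numbers E_1, …, E_N ≥ 0 with Σ_{n=1}^{N} E_n ≤ E such that for every density matrix ρ and every n, Tr[(H_{2n−1} ⊗ I)(C*ρ)] − Tr[(H_{2n−2} ⊗ I) ρ] ≤ E_n; (ii) Σ_{n=1}^{N} max{ λ_max(O'_n), 0 } ≤ E, where O'_n := Tr_{1,3,…,2N−1}[(H_{2n−1} ⊗ I) C] − (H_{2n−2})^T ⊗ I. -/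

import Mathlib

noncomputable section

open scoped BigOperators ComplexOrder

/-- Entrywise tensor (Kronecker) product of square matrices on a product index type. -/
def tens {α β : Type*} (M : Matrix α α ℂ) (P : Matrix β β ℂ) :
    Matrix (α × β) (α × β) ℂ :=
  Matrix.of fun p q => M p.1 q.1 * P p.2 q.2

/-- Partial trace over the first tensor factor. -/
def ptrFst {α β : Type*} [Fintype α] (M : Matrix (α × β) (α × β) ℂ) : Matrix β β ℂ :=
  Matrix.of fun b b' => ∑ a : α, M (a, b) (a, b')

/-- Partial trace over the second tensor factor. -/
def ptrSnd {α β : Type*} [Fintype β] (M : Matrix (α × β) (α × β) ℂ) : Matrix α α ℂ :=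
  Matrix.of fun a a' => ∑ b : β, M (a, b) (a', b)

/-- The largest eigenvalue of a Hermitian matrix, characterized via the Loewner order:
`lamMax M` is the least real `c` such that `c·I − M` is positive semidefinite. -/
def lamMax {α : Type*} [Fintype α] [DecidableEq α] (M : Matrix α α ℂ) : ℝ :=
  sInf {c : ℝ | ((c : ℂ) • (1 : Matrix α α ℂ) - M).PosSemidef}

/-- `H_m ⊗ I`: a Hamiltonian acting on the `m`-th tensor factor, extended by the identity
to the whole tensor product `⊗_k ℂ^(A k)`. -/
def embedAt {N : ℕ} {A : Fin N → ℕ} (m : Fin N)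
    (M : Matrix (Fin (A m)) (Fin (A m)) ℂ) :
    Matrix (∀ k, Fin (A k)) (∀ k, Fin (A k)) ℂ :=
  Matrix.of fun a b =>
    M (a m) (b m) * ∏ k ∈ Finset.univ.erase m, (if a k = b k then (1 : ℂ) else 0)

/-- `C` is (the Choi operator of) an `N`-step quantum comb whose `m`-th input space is
`ℂ^(A m)` (the space `ℋ_{2m−2}`) and whose `m`-th output space is `ℂ^(B m)` (the space
`ℋ_{2m−1}`): `C` is positive semidefinite and there are Choi operators `Csub n` of the
sub-processes consisting of the first `n` steps, satisfying the recursive causality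
conditions `Tr_{2n−1}[C^(n)] = C^(n−1) ⊗ I_{2n−2}` (with `C^(0) = 1`). -/
def IsComb {N : ℕ} {A B : Fin N → ℕ}
    (C : Matrix ((∀ m, Fin (A m)) × (∀ m, Fin (B m)))
      ((∀ m, Fin (A m)) × (∀ m, Fin (B m))) ℂ) : Prop :=
  C.PosSemidef ∧
  ∃ Csub : (n : ℕ) → (h : n ≤ N) →
      Matrix ((∀ m : Fin n, Fin (A (Fin.castLE h m))) × (∀ m : Fin n, Fin (B (Fin.castLE h m))))
        ((∀ m : Fin n, Fin (A (Fin.castLE h m))) × (∀ m : Fin n, Fin (B (Fin.castLE h m)))) ℂ,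
    Csub N le_rfl = C ∧
    Csub 0 (Nat.zero_le N) = 1 ∧
    ∀ (n : ℕ) (h : n + 1 ≤ N)
      (a a' : ∀ m : Fin (n + 1), Fin (A (Fin.castLE h m)))
      (c c' : ∀ m : Fin n, Fin (B (Fin.castLE (Nat.le_of_succ_le h) m))),
      (∑ g : Fin (B (Fin.castLE h (Fin.last n))),
        Csub (n + 1) h (a, Fin.snoc c g) (a', Fin.snoc c' g)) =
      Csub n (Nat.le_of_succ_le h) (Fin.init a, c) (Fin.init a', c') *
        (if a (Fin.last n) = a' (Fin.last n) then 1 else 0)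

/-- The joint output state `C*ρ := Tr_inputs[C (ρ^T ⊗ I_outputs)]` produced by feeding the
joint input state `ρ` into the comb `C`. -/
def Cstar {N : ℕ} {A B : Fin N → ℕ}
    (C : Matrix ((∀ m, Fin (A m)) × (∀ m, Fin (B m)))
      ((∀ m, Fin (A m)) × (∀ m, Fin (B m))) ℂ)
    (ρ : Matrix (∀ m, Fin (A m)) (∀ m, Fin (A m)) ℂ) :
    Matrix (∀ m, Fin (B m)) (∀ m, Fin (B m)) ℂ :=
  ptrFst (C * tens ρ.transpose 1)

/-- The trace of a product of two positive semidefinite matrices is nonnegative. -/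
theorem trace_mul_nonneg_of_posSemidef {α : Type*} [Fintype α] {P Q : Matrix α α ℂ}
    (hP : P.PosSemidef) (hQ : Q.PosSemidef) : 0 ≤ (P * Q).trace := by
  obtain ⟨m, v, rfl⟩ := Matrix.posSemidef_iff_eq_sum_vecMulVec.mp hQ
  rw [Matrix.mul_sum, Matrix.trace_sum]
  refine Finset.sum_nonneg fun i _ => ?_
  rw [Matrix.mul_vecMulVec, Matrix.trace_vecMulVec, dotProduct_comm]
  exact hP.dotProduct_mulVec_nonneg _

/-- A Hermitian matrix is bounded above, in the Loewner order, by a multiple of the identity. -/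
theorem exists_posSemidef_smul_one_sub {α : Type*} [Fintype α] [DecidableEq α]
    {M : Matrix α α ℂ} (hM : M.IsHermitian) :
    ∃ c : ℝ, ((c : ℂ) • (1 : Matrix α α ℂ) - M).PosSemidef := by
  obtain ⟨c, hc⟩ := (Set.finite_range hM.eigenvalues).bddAbove
  refine ⟨c, ?_⟩
  have hD : (Matrix.diagonal fun i => (c : ℂ) - hM.eigenvalues i).PosSemidef :=
    Matrix.PosSemidef.diagonal fun i => by
      simpa using hc ⟨i, rfl⟩
  have h := hD.mul_mul_conjTranspose_same (hM.eigenvectorUnitary : Matrix α α ℂ)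
  convert h using 1
  have hd : (Matrix.diagonal fun i => (c : ℂ) - hM.eigenvalues i) =
      (c : ℂ) • (1 : Matrix α α ℂ) - Matrix.diagonal (RCLike.ofReal ∘ hM.eigenvalues) := by
    rw [Matrix.smul_one_eq_diagonal, Matrix.diagonal_sub]
    rfl
  conv_lhs => rw [hM.spectral_theorem, Unitary.conjStarAlgAut_apply]
  rw [hd, mul_sub, sub_mul, ← Matrix.star_eq_conjTranspose]
  simp

/-- `c • 1 - M` is positive semidefinite iff every state has expectation value at most `c`. -/
theorem posSemidef_smul_one_sub_iff {α : Type*} [Fintype α] [DecidableEq α]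
    {M : Matrix α α ℂ} (hM : M.IsHermitian) (c : ℝ) :
    ((c : ℂ) • (1 : Matrix α α ℂ) - M).PosSemidef ↔
      ∀ σ : Matrix α α ℂ, σ.PosSemidef → σ.trace = 1 → (M * σ).trace.re ≤ c := by
  constructor
  · intro h σ hσ htr
    have := (Complex.le_def.mp (trace_mul_nonneg_of_posSemidef h hσ)).1
    simpa [sub_mul, htr] using this
  · intro h
    have hH : ((c : ℂ) • (1 : Matrix α α ℂ) - M).IsHermitian := by
      refine Matrix.IsHermitian.sub ?_ hM
      simp [Matrix.IsHermitian]
    refine .of_dotProduct_mulVec_nonneg hH fun x => ?_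
    rcases eq_or_ne x 0 with rfl | hx
    · simp
    have hpos : 0 < star x ⬝ᵥ x := Matrix.dotProduct_star_self_pos_iff.mpr hx
    obtain ⟨hre, him⟩ := Complex.lt_def.mp hpos
    set r : ℝ := (star x ⬝ᵥ x).re
    have hxr : star x ⬝ᵥ x = (r : ℂ) := Complex.ext rfl him.symm
    have hr0 : 0 < r := hre
    have hσ := h (((r⁻¹ : ℝ) : ℂ) • Matrix.vecMulVec x (star x))
      ((Matrix.posSemidef_vecMulVec_self_star x).smul
        (Complex.zero_le_real.mpr (inv_nonneg.mpr hr0.le)))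
      (by
        rw [Matrix.trace_smul, Matrix.trace_vecMulVec, dotProduct_comm, hxr, smul_eq_mul,
          ← Complex.ofReal_mul, inv_mul_cancel₀ hr0.ne', Complex.ofReal_one])
    rw [Matrix.mul_smul, Matrix.trace_smul, Matrix.mul_vecMulVec, Matrix.trace_vecMulVec,
      dotProduct_comm, smul_eq_mul, Complex.re_ofReal_mul, inv_mul_le_iff₀ hr0] at hσ
    have him := hH.im_star_dotProduct_mulVec_self x
    refine Complex.le_def.mpr ⟨?_, him.symm⟩
    rw [Matrix.sub_mulVec, dotProduct_sub, Matrix.smul_mulVec, Matrix.one_mulVec,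
      dotProduct_smul, hxr]
    simp only [smul_eq_mul, Complex.sub_re, Complex.re_ofReal_mul, Complex.ofReal_re,
      Complex.zero_re]
    linarith

/-- `lamMax M` is the supremum of the expectation values of a Hermitian matrix `M` over all
states. -/
theorem lamMax_le_iff {α : Type*} [Fintype α] [DecidableEq α] [Nonempty α]
    {M : Matrix α α ℂ} (hM : M.IsHermitian) (c : ℝ) :
    lamMax M ≤ c ↔
      ∀ σ : Matrix α α ℂ, σ.PosSemidef → σ.trace = 1 → (M * σ).trace.re ≤ c := by
  constructor
  · intro h σ hσ htr
    refine le_trans (le_csInf (exists_posSemidef_smul_one_sub hM) fun b hb => ?_) h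
    exact (posSemidef_smul_one_sub_iff hM b).mp hb σ hσ htr
  · intro h
    refine csInf_le ?_ ((posSemidef_smul_one_sub_iff hM c).mpr h)
    obtain ⟨i⟩ := ‹Nonempty α›
    refine ⟨(M i i).re, fun b hb => ?_⟩
    simpa using (Complex.le_def.mp (Matrix.PosSemidef.diag_nonneg hb (i := i))).1

theorem isHermitian_embedAt {N : ℕ} {A : Fin N → ℕ} (m : Fin N)
    {M : Matrix (Fin (A m)) (Fin (A m)) ℂ} (hM : M.IsHermitian) :
    (embedAt m M).IsHermitian := by
  ext a b
  simp only [embedAt, Matrix.conjTranspose_apply, Matrix.of_apply, star_mul', hM.apply,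
    star_prod, apply_ite star, star_one, star_zero, eq_comm]

theorem tens_one_mul_apply {α β : Type*} [Fintype α] [Fintype β] [DecidableEq α]
    (P : Matrix β β ℂ) (C : Matrix (α × β) (α × β) ℂ) (a : α) (b : β) (q : α × β) :
    (tens (1 : Matrix α α ℂ) P * C) (a, b) q = ∑ d, P b d * C (a, d) q := by
  simp [Matrix.mul_apply, tens, Fintype.sum_prod_type, Matrix.one_apply]

theorem mul_tens_one_apply {α β : Type*} [Fintype α] [Fintype β] [DecidableEq β]
    (M : Matrix α α ℂ) (C : Matrix (α × β) (α × β) ℂ) (p : α × β) (a : α) (b : β) :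
    (C * tens M (1 : Matrix β β ℂ)) p (a, b) = ∑ d, C p (d, b) * M d a := by
  simp [Matrix.mul_apply, tens, Fintype.sum_prod_type, Matrix.one_apply]

theorem isHermitian_ptrSnd_tens_one_mul {α β : Type*} [Fintype α] [Fintype β] [DecidableEq α]
    {P : Matrix β β ℂ} {C : Matrix (α × β) (α × β) ℂ} (hP : P.IsHermitian)
    (hC : C.IsHermitian) : (ptrSnd (tens (1 : Matrix α α ℂ) P * C)).IsHermitian := by
  ext a a'
  simp only [ptrSnd, Matrix.conjTranspose_apply, Matrix.of_apply, tens_one_mul_apply, star_sum,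
    star_mul', hP.apply, hC.apply]
  exact Finset.sum_comm

/-- The energy of an output of `C` as an expectation value on the input. -/
theorem trace_mul_ptrFst_mul_tens_one {α β : Type*} [Fintype α] [Fintype β] [DecidableEq α]
    [DecidableEq β] (P : Matrix β β ℂ) (M : Matrix α α ℂ) (C : Matrix (α × β) (α × β) ℂ) :
    (P * ptrFst (C * tens M 1)).trace =
      (ptrSnd (tens (1 : Matrix α α ℂ) P * C) * M).trace := by
  simp only [Matrix.trace, Matrix.diag, Matrix.mul_apply (M := P),
    Matrix.mul_apply (M := ptrSnd (tens (1 : Matrix α α ℂ) P * C))]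
  simp only [ptrFst, ptrSnd, Matrix.of_apply, tens_one_mul_apply, mul_tens_one_apply,
    Finset.mul_sum, Finset.sum_mul]
  calc _ = ∑ b, ∑ a, ∑ b', ∑ a', P b b' * (C (a, b') (a', b) * M a' a) :=
        Finset.sum_congr rfl fun b _ => Finset.sum_comm
    _ = ∑ a, ∑ b, ∑ b', ∑ a', P b b' * (C (a, b') (a', b) * M a' a) := Finset.sum_comm
    _ = ∑ a, ∑ b, ∑ a', ∑ b', P b b' * (C (a, b') (a', b) * M a' a) :=
        Finset.sum_congr rfl fun a _ => Finset.sum_congr rfl fun b _ => Finset.sum_comm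
    _ = ∑ a, ∑ a', ∑ b, ∑ b', P b b' * (C (a, b') (a', b) * M a' a) :=
        Finset.sum_congr rfl fun a _ => Finset.sum_comm
    _ = _ := by simp only [mul_assoc]

/-- Theorem 1 of the paper, local-battery case.
An `N`-step quantum comb `C` (with `m`-th input space `ℋ_{2m−2} = ℂ^(A m)` carrying the
Hermitian Hamiltonian `HA m`, and `m`-th output space `ℋ_{2m−1} = ℂ^(B m)` carrying the
Hermitian Hamiltonian `HB m`) admits local batteries of nonnegative energies `E_1,…,E_N`
with `Σ_n E_n ≤ E` — i.e. for every joint input density matrix `ρ` and every `n`, the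
energy increase in the `n`-th step is at most `E_n` — if and only if
`Σ_n max{λ_max(O'_n), 0} ≤ E`, where
`O'_n = Tr_outputs[(H_{2n−1} ⊗ I) C] − (H_{2n−2})^T ⊗ I`. -/
theorem energy_constrained_comb_local
    (N : ℕ) (hN : 1 ≤ N) (A B : Fin N → ℕ)
    (hA : ∀ m, 0 < A m) (hB : ∀ m, 0 < B m)
    (HA : ∀ m, Matrix (Fin (A m)) (Fin (A m)) ℂ)
    (HB : ∀ m, Matrix (Fin (B m)) (Fin (B m)) ℂ)
    (hHA : ∀ m, (HA m).IsHermitian) (hHB : ∀ m, (HB m).IsHermitian)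
    (C : Matrix ((∀ m, Fin (A m)) × (∀ m, Fin (B m)))
      ((∀ m, Fin (A m)) × (∀ m, Fin (B m))) ℂ)
    (hC : IsComb C) (E : ℝ) :
    (∃ e : Fin N → ℝ, (∀ n, 0 ≤ e n) ∧ (∑ n, e n) ≤ E ∧
      ∀ ρ : Matrix (∀ m, Fin (A m)) (∀ m, Fin (A m)) ℂ,
        ρ.PosSemidef → ρ.trace = 1 →
        ∀ n : Fin N,
          (embedAt n (HB n) * Cstar C ρ).trace.re -
            (embedAt n (HA n) * ρ).trace.re ≤ e n)
    ↔
    (∑ n : Fin N,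
      max (lamMax
        (ptrSnd
          (tens (1 : Matrix (∀ m, Fin (A m)) (∀ m, Fin (A m)) ℂ)
            (embedAt n (HB n)) * C) -
          (embedAt n (HA n)).transpose)) 0 ≤ E) := by
  have : Nonempty (∀ m, Fin (A m)) := ⟨fun m => ⟨0, hA m⟩⟩
  set O : Fin N → Matrix (∀ m, Fin (A m)) (∀ m, Fin (A m)) ℂ := fun n =>
    ptrSnd (tens (1 : Matrix (∀ m, Fin (A m)) (∀ m, Fin (A m)) ℂ) (embedAt n (HB n)) * C) -
      (embedAt n (HA n)).transpose
  have hOH : ∀ n, (O n).IsHermitian := fun n =>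
    (isHermitian_ptrSnd_tens_one_mul (isHermitian_embedAt n (hHB n)) hC.1.isHermitian).sub
      (isHermitian_embedAt n (hHA n)).transpose
  have htrace : ∀ n (ρ : Matrix (∀ m, Fin (A m)) (∀ m, Fin (A m)) ℂ),
      (embedAt n (HB n) * Cstar C ρ).trace.re - (embedAt n (HA n) * ρ).trace.re =
        (O n * ρ.transpose).trace.re := fun n ρ => by
    rw [Cstar, trace_mul_ptrFst_mul_tens_one, sub_mul, Matrix.trace_sub, Complex.sub_re,
      ← Matrix.transpose_mul, Matrix.trace_transpose, Matrix.trace_mul_comm ρ]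
  constructor
  · rintro ⟨e, he0, hsum, he⟩
    refine le_trans (Finset.sum_le_sum fun n _ => max_le ?_ (he0 n)) hsum
    refine (lamMax_le_iff (hOH n) _).mpr fun σ hσ htr => ?_
    have h := he σ.transpose hσ.transpose (by rwa [Matrix.trace_transpose]) n
    rwa [htrace, Matrix.transpose_transpose] at h
  · intro h
    refine ⟨fun n => max (lamMax (O n)) 0, fun n => le_max_right _ _, h, fun ρ hρ htr n => ?_⟩
    rw [htrace]
    exact (lamMax_le_iff (hOH n) _).mp (le_max_left _ _) _ hρ.transpose
      (by rwa [Matrix.trace_transpose])
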